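/- arXiv:math/0501198 — 2 statements merged into one kernel-verified Lean document; each statement's English description precedes it below -/
import Mathlib

section
/- Let k be a real or imaginary quadratic number field in which t primes of ℚ ramify. Then the 2-rank of the ideal class group of k is at most t - 1 (in particular, #{c ∈ Cl(k) : c² = 1} ≤ 2^{t-1}). -/
open NumberField

namespace QuadraticGenus

theorem relIndex_le_card {G : Type*} [CommGroup G] {H K : Subgroup G} {α : Type*} [Finite α]
    (f : K → α) (hf : ∀ x y, f x = f y → (x : G)⁻¹ * y ∈ H) :
    H.relIndex K ≠ 0 ∧ H.relIndex K ≤ Nat.card α := by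
  have hinj : Function.Injective fun x : K ⧸ H.subgroupOf K => f x.out := by
    intro x y hxy
    rw [← x.out_eq', ← y.out_eq', QuotientGroup.eq]
    exact hf _ _ hxy
  have := Finite.of_injective _ hinj
  exact ⟨Subgroup.index_ne_zero_of_finite, Nat.card_le_card_of_injective _ hinj⟩

theorem card_le_relIndex {G : Type*} [CommGroup G] {H K : Subgroup G} (h0 : H.relIndex K ≠ 0)
    {α : Type*} (f : α → K) (hf : ∀ x y, (f x : G)⁻¹ * f y ∈ H → x = y) :
    Nat.card α ≤ H.relIndex K := by
  have : Finite (K ⧸ H.subgroupOf K) := Nat.finite_of_card_ne_zero h0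
  refine Nat.card_le_card_of_injective (fun x => (f x : K ⧸ H.subgroupOf K)) fun x y hxy => ?_
  exact hf _ _ ((QuotientGroup.eq (s := H.subgroupOf K)).mp hxy)

theorem two_le_relIndex {G : Type*} [CommGroup G] {H K : Subgroup G} (h0 : H.relIndex K ≠ 0)
    {g : G} (hK : g ∈ K) (hH : g ∉ H) : 2 ≤ H.relIndex K := by
  have : H.relIndex K ≠ 1 := fun h => hH (Subgroup.relIndex_eq_one.mp h hK)
  omega

theorem exists_squarefree_rep (q : ℚˣ) : ∃ (ε : ℤˣ) (s : ℕ) (r : ℚˣ), Squarefree s ∧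
    (q : ℚ) = (ε : ℤ) * s * (r : ℚ) ^ 2 := by
  have hq : (q : ℚ) ≠ 0 := q.ne_zero
  obtain ⟨s, b, hs, hb, h, hsq⟩ := Nat.sq_mul_squarefree_of_pos
    (n := (q : ℚ).num.natAbs * (q : ℚ).den) (Nat.mul_pos (by simp) (q : ℚ).den_pos)
  have hd : ((q : ℚ).den : ℚ) ≠ 0 := by exact_mod_cast (q : ℚ).den_nz
  have hb0 : (b : ℚ) ≠ 0 := by exact_mod_cast hb.ne'
  have h' : (b : ℚ) ^ 2 * s = |((q : ℚ).num : ℚ)| * (q : ℚ).den := by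
    have := congrArg (Nat.cast : ℕ → ℚ) h
    push_cast [Nat.cast_natAbs] at this
    exact this
  have habs : |(q : ℚ)| = s * (b / (q : ℚ).den) ^ 2 := by
    conv_lhs => rw [← Rat.num_div_den (q : ℚ)]
    rw [abs_div, Nat.abs_cast]
    field_simp
    linear_combination -h'
  rcases abs_choice (q : ℚ) with hc | hc
  · exact ⟨1, s, Units.mk0 (b / (q : ℚ).den) (div_ne_zero hb0 hd), hsq, by simp [← habs, hc]⟩
  · refine ⟨-1, s, Units.mk0 (b / (q : ℚ).den) (div_ne_zero hb0 hd), hsq, ?_⟩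
    simp [← habs, hc]

variable {k : Type*} [Field k] [NumberField k]

theorem sq_sub_trace_mul_add_norm (h2 : Module.finrank ℚ k = 2) (a : k) :
    a ^ 2 - algebraMap ℚ k (Algebra.trace ℚ k a) * a + algebraMap ℚ k (Algebra.norm ℚ a) = 0 := by
  let b := Module.finBasisOfFinrankEq ℚ k h2
  apply Algebra.leftMulMatrix_injective b
  have h := Matrix.aeval_self_charpoly (Algebra.leftMulMatrix b a)
  rw [Matrix.charpoly_fin_two] at h
  rw [map_zero, ← h, Algebra.trace_eq_matrix_trace b, Algebra.norm_eq_matrix_det b]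
  simp only [map_add, map_sub, map_mul, map_pow, AlgHom.commutes, Polynomial.aeval_X,
    Polynomial.aeval_C]

/-- The elements of `kˣ` that, up to a square, generate the square of an ideal. -/
def idealSquares (k : Type*) [Field k] [NumberField k] : Subgroup kˣ where
  carrier := {a | ∃ (z : kˣ) (b : 𝓞 k) (J : Ideal (𝓞 k)),
    (b : k) = a * z ^ 2 ∧ J ^ 2 = Ideal.span {b}}
  one_mem' := ⟨1, 1, 1, by simp, by simp⟩
  mul_mem' := by
    rintro a a' ⟨z, b, J, h, hJ⟩ ⟨z', b', J', h', hJ'⟩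
    refine ⟨z * z', b * b', J * J', ?_, ?_⟩
    · rw [show ((b * b' : 𝓞 k) : k) = b * b' from map_mul (algebraMap (𝓞 k) k) b b', h, h']
      push_cast
      ring
    · rw [mul_pow, hJ, hJ', Ideal.span_singleton_mul_span_singleton]
  inv_mem' := by
    rintro a ⟨z, b, J, h, hJ⟩
    refine ⟨a * z, b, J, ?_, hJ⟩
    rw [h]
    push_cast
    field_simp

theorem square_le_idealSquares : Subgroup.square kˣ ≤ idealSquares k := by
  intro a ha
  obtain ⟨x, rfl⟩ := Subgroup.mem_square.mp ha
  refine ⟨x⁻¹, 1, 1, ?_, by simp⟩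
  push_cast
  field_simp

/-- The units of the ring of integers, as a subgroup of `kˣ`. -/
abbrev integralUnits (k : Type*) [Field k] : Subgroup kˣ :=
  (Units.map (algebraMap (𝓞 k) k : 𝓞 k →* k)).range

theorem integralUnits_le_idealSquares : integralUnits k ≤ idealSquares k := by
  rintro _ ⟨u, rfl⟩
  exact ⟨1, u, 1, by simp, by simp [Ideal.span_singleton_eq_top.mpr u.isUnit]⟩

theorem exists_sq_eq_abs_norm {a : kˣ} (ha : a ∈ idealSquares k) :
    ∃ m : ℚ, m ^ 2 = |Algebra.norm ℚ (a : k)| := by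
  obtain ⟨z, b, J, h, hJ⟩ := ha
  refine ⟨J.absNorm / |Algebra.norm ℚ (z : k)|, ?_⟩
  have hb : ((J.absNorm : ℚ)) ^ 2 = |Algebra.norm ℚ (b : k)| := by
    rw [← Nat.cast_pow, ← map_pow, hJ, Ideal.absNorm_span_singleton,
      Nat.cast_natAbs, Int.cast_abs, Algebra.coe_norm_int]
  have hz : Algebra.norm ℚ (z : k) ≠ 0 := Algebra.norm_ne_zero_iff.mpr z.ne_zero
  rw [div_pow, hb, h, map_mul, map_pow, abs_mul, abs_pow]
  field_simp

theorem notMem_sq_of_not_dvd_discr {p : ℕ} (hp : p.Prime) (hd : ¬ (p : ℤ) ∣ discr k)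
    {P : Ideal (𝓞 k)} [P.IsPrime] (hP : (p : 𝓞 k) ∈ P) : (p : 𝓞 k) ∉ P ^ 2 := by
  intro h
  have hpZ := Nat.prime_iff_prime_int.mp hp
  have hu := (not_dvd_discr_iff_forall_mem k (𝓞 k) hpZ).mp hd P inferInstance (by simpa using hP)
  refine not_dvd_differentIdeal_iff.mpr hu ?_
  have : (Ideal.span {(p : ℤ)}).IsMaximal :=
    PrincipalIdealRing.isMaximal_of_irreducible hpZ.irreducible
  simpa using pow_sub_one_dvd_differentIdeal ℤ (p := Ideal.span {(p : ℤ)}) P 2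
    (by simpa using hp.ne_zero)
    (by simpa [Ideal.map_span, Ideal.dvd_span_singleton] using h)

open WithZero in
theorem not_isSquare_exp_neg_one : ¬ IsSquare (exp (-1) : ℤᵐ⁰) := by
  rintro ⟨x, hx⟩
  have hx0 : x ≠ 0 := by rintro rfl; simp at hx
  rw [← exp_log hx0, ← exp_add, exp_inj] at hx
  omega

theorem isSquare_valuation {a : kˣ} (ha : a ∈ idealSquares k)
    (v : IsDedekindDomain.HeightOneSpectrum (𝓞 k)) : IsSquare (v.valuation k (a : k)) := by
  obtain ⟨z, b, J, h, hJ⟩ := ha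
  have hb0 : b ≠ 0 := by
    rintro rfl
    simp at h
  have hJ0 : J ≠ 0 := by
    rintro rfl
    exact hb0 (Ideal.span_singleton_eq_bot.mp (by simpa using hJ.symm))
  have hb : IsSquare (v.valuation k (b : k)) := by
    rw [v.valuation_of_algebraMap, v.intValuation_eq_exp_neg_multiplicity hb0, ← hJ,
      (FiniteMultiplicity.of_prime_left v.prime hJ0).multiplicity_pow v.prime]
    refine ⟨WithZero.exp (-multiplicity v.asIdeal J : ℤ), ?_⟩
    rw [← WithZero.exp_add]
    congr 1
    push_cast
    ring
  have ha : (a : k) = b * (z : k)⁻¹ * (z : k)⁻¹ := by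
    rw [h]
    field_simp
  rw [ha, map_mul, map_mul, mul_assoc]
  exact hb.mul ⟨_, rfl⟩

/-- A prime dividing the squarefree part of a rational element of `idealSquares` ramifies. -/
theorem dvd_discr_of_dvd_squarefree {a : kˣ} (ha : a ∈ idealSquares k) {s : ℕ} (hs : Squarefree s)
    {r : ℚ} {ε : ℤˣ} (hr : (a : k) = algebraMap ℚ k ((ε : ℤ) * s * r ^ 2)) {p : ℕ}
    (hp : p.Prime) (hps : p ∣ s) :
    (p : ℤ) ∣ discr k := by
  by_contra hd
  have hpZ := Nat.prime_iff_prime_int.mp hp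
  have : (Ideal.span {(p : ℤ)}).IsMaximal :=
    PrincipalIdealRing.isMaximal_of_irreducible hpZ.irreducible
  obtain ⟨P, hP, hPo⟩ := Ideal.exists_maximal_ideal_liesOver_of_isIntegral
    (S := 𝓞 k) (Ideal.span {(p : ℤ)})
  have hpP : (p : 𝓞 k) ∈ P := by
    simpa using (Ideal.liesOver_span_iff hP.ne_top hpZ).mp hPo
  have hp0 : (p : 𝓞 k) ≠ 0 := by exact_mod_cast hp.ne_zero
  let v : IsDedekindDomain.HeightOneSpectrum (𝓞 k) :=
    ⟨P, hP.isPrime, fun h => hp0 (by simpa [h] using hpP)⟩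
  obtain ⟨m, rfl⟩ := hps
  have hm : (m : 𝓞 k) ∉ P := by
    intro hm
    have hc : IsCoprime (p : ℤ) (m : ℤ) :=
      Nat.isCoprime_iff_coprime.mpr (Nat.coprime_of_squarefree_mul hs)
    obtain ⟨x, y, hxy⟩ := hc
    apply hP.ne_top
    rw [Ideal.eq_top_iff_one]
    have : (1 : 𝓞 k) = x * p + y * m := by exact_mod_cast congrArg (Int.cast : ℤ → 𝓞 k) hxy.symm
    rw [this]
    exact P.add_mem (P.mul_mem_left _ hpP) (P.mul_mem_left _ hm)
  have hvp : v.valuation k (p : k) = WithZero.exp (-1) := by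
    have h1 := (v.intValuation_le_pow_iff_mem (p : 𝓞 k) 1).mpr (by simpa using hpP)
    have h2 := (v.intValuation_le_pow_iff_mem (p : 𝓞 k) 2).not.mpr
      (notMem_sq_of_not_dvd_discr hp hd hpP)
    have h3 : v.valuation k (p : k) = v.intValuation (p : 𝓞 k) := by
      rw [← v.valuation_of_algebraMap (K := k)]
      simp
    rw [h3]
    rw [v.intValuation_eq_exp_neg_multiplicity hp0] at h1 h2 ⊢
    rw [WithZero.exp_le_exp] at h1 h2
    congr 1
    push_cast at h1 h2
    omega
  have hvm : v.valuation k (m : k) = 1 := by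
    have := (v.valuation_eq_one_iff_notMem (K := k) (r := (m : 𝓞 k))).mpr hm
    simpa using this
  have hve : v.valuation k ((ε : ℤ) : k) = 1 := by
    rcases Int.units_eq_one_or ε with rfl | rfl <;> simp
  have h := isSquare_valuation ha v
  have hr0 : algebraMap ℚ k r ≠ 0 := by
    intro h0
    apply a.ne_zero
    rw [hr, map_mul, map_pow, h0, zero_pow two_ne_zero, mul_zero]
  have hvr : v.valuation k (algebraMap ℚ k r) ≠ 0 := (Valuation.ne_zero_iff _).mpr hr0
  rw [hr] at h
  simp only [map_mul, map_pow, map_intCast, map_natCast, Nat.cast_mul, hvp, hvm, hve, one_mul,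
    mul_one] at h
  apply not_isSquare_exp_neg_one
  have := h.mul (IsSquare.sq (v.valuation k (algebraMap ℚ k r))⁻¹)
  rwa [mul_assoc, ← mul_pow, mul_inv_cancel₀ hvr, one_pow, mul_one] at this

/-- The rational numbers in `idealSquares k`. -/
abbrev ratIdealSquares (k : Type*) [Field k] [NumberField k] : Subgroup ℚˣ :=
  (idealSquares k).comap (Units.map (algebraMap ℚ k : ℚ →* k))

theorem relIndex_square_ratIdealSquares :
    (Subgroup.square ℚˣ).relIndex (ratIdealSquares k) ≠ 0 ∧
    (Subgroup.square ℚˣ).relIndex (ratIdealSquares k) ≤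
      2 * 2 ^ (discr k).natAbs.primeFactors.card := by
  choose ε s r hs hr using exists_squarefree_rep
  have hmem (q : ratIdealSquares k) :
      (s q).primeFactors ∈ (discr k).natAbs.primeFactors.powerset := by
    rw [Finset.mem_powerset]
    intro p hp
    rw [Nat.mem_primeFactors] at hp ⊢
    refine ⟨hp.1, ?_, by simpa using discr_ne_zero k⟩
    exact Int.natCast_dvd.mp (dvd_discr_of_dvd_squarefree q.2 (hs q)
      (congrArg (algebraMap ℚ k) (hr q)) hp.1 hp.2.1)
  have h := relIndex_le_card (H := Subgroup.square ℚˣ)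
    (fun q : ratIdealSquares k => (ε q, (⟨_, hmem q⟩ : (discr k).natAbs.primeFactors.powerset)))
    fun x y hxy => by
      simp only [Prod.mk.injEq, Subtype.mk.injEq] at hxy
      have hsxy : s x = s y := by
        rw [← Nat.prod_primeFactors_of_squarefree (hs x), hxy.2,
          Nat.prod_primeFactors_of_squarefree (hs y)]
      rw [Subgroup.mem_square]
      refine ⟨(r x)⁻¹ * r y, ?_⟩
      have hs0 : (s (y : ℚˣ) : ℚ) ≠ 0 := by exact_mod_cast (hs y).ne_zero
      have hε : (((ε (y : ℚˣ) : ℤˣ) : ℤ) : ℚ) ≠ 0 := by exact_mod_cast (ε (y : ℚˣ)).ne_zero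
      ext
      push_cast
      rw [hr x, hr y, hxy.1, hsxy]
      field_simp
  refine ⟨h.1, h.2.trans (le_of_eq ?_)⟩
  rw [Nat.card_prod, Nat.card_eq_fintype_card, Nat.card_eq_fintype_card, Fintype.card_coe,
    Finset.card_powerset]
  rfl

theorem exists_rat_isSquare_not_isSquare (h2 : Module.finrank ℚ k = 2) :
    ∃ d : ℚˣ, IsSquare (Units.map (algebraMap ℚ k : ℚ →* k) d) ∧ ¬ IsSquare d := by
  obtain ⟨a, ha⟩ : ∃ a : k, a ∉ Set.range (algebraMap ℚ k) := by
    by_contra! h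
    have := (Subalgebra.bot_eq_top_iff_finrank_eq_one (F := ℚ) (E := k)).mp
      (eq_top_iff.mpr fun x _ => Algebra.mem_bot.mpr (h x))
    omega
  set t := Algebra.trace ℚ k a
  set n := Algebra.norm ℚ a
  have hsq : (2 * a - algebraMap ℚ k t) ^ 2 = algebraMap ℚ k (t ^ 2 - 4 * n) := by
    simp only [map_sub, map_mul, map_pow, map_ofNat]
    linear_combination 4 * sq_sub_trace_mul_add_norm h2 a
  have key (y : ℚ) : 2 * a - algebraMap ℚ k t ≠ algebraMap ℚ k y := fun h =>
    ha ⟨(y + t) / 2, by simp only [map_div₀, map_add, map_ofNat]; linear_combination -h / 2⟩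
  have hroot : 2 * a - algebraMap ℚ k t ≠ 0 := by simpa using key 0
  have hd : t ^ 2 - 4 * n ≠ 0 := fun h => hroot (by simpa [h] using hsq)
  refine ⟨Units.mk0 _ hd, ⟨Units.mk0 _ hroot, ?_⟩, ?_⟩
  · ext
    simpa [sq] using hsq.symm
  · rintro ⟨y, hy⟩
    have hy' : t ^ 2 - 4 * n = (y : ℚ) ^ 2 := by
      simpa [sq] using congrArg Units.val hy
    rw [hy', map_pow, sq_eq_sq_iff_eq_or_eq_neg] at hsq
    rcases hsq with h | h
    · exact key _ h
    · exact key (-y) (by simpa using h)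

theorem relIndex_square_map_ratIdealSquares (h2 : Module.finrank ℚ k = 2) :
    (Subgroup.square kˣ).relIndex
      ((ratIdealSquares k).map (Units.map (algebraMap ℚ k : ℚ →* k))) ≠ 0 ∧
    (Subgroup.square kˣ).relIndex
      ((ratIdealSquares k).map (Units.map (algebraMap ℚ k : ℚ →* k))) ≤
      2 ^ (discr k).natAbs.primeFactors.card := by
  rw [← Subgroup.relIndex_comap]
  set H := (Subgroup.square kˣ).comap (Units.map (algebraMap ℚ k : ℚ →* k))
  obtain ⟨h0, hle⟩ := relIndex_square_ratIdealSquares (k := k)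
  have hsH : Subgroup.square ℚˣ ≤ H := fun q hq =>
    Subgroup.mem_square.mpr ((Subgroup.mem_square.mp hq).map _)
  have hHT : H ≤ ratIdealSquares k := Subgroup.comap_mono square_le_idealSquares
  rw [← Subgroup.relIndex_mul_relIndex _ _ _ hsH hHT] at h0 hle
  obtain ⟨d, hd, hd'⟩ := exists_rat_isSquare_not_isSquare h2
  have := two_le_relIndex (left_ne_zero_of_mul h0) (g := d) (Subgroup.mem_square.mpr hd)
    (fun h => hd' (Subgroup.mem_square.mp h))
  refine ⟨right_ne_zero_of_mul h0, ?_⟩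
  nlinarith

theorem mem_sup_of_norm_pos (h2 : Module.finrank ℚ k = 2) {a : kˣ} (ha : a ∈ idealSquares k)
    (hpos : 0 < Algebra.norm ℚ (a : k)) :
    a ∈ Subgroup.square kˣ ⊔ (ratIdealSquares k).map (Units.map (algebraMap ℚ k : ℚ →* k)) := by
  obtain ⟨m, hm⟩ := exists_sq_eq_abs_norm ha
  rw [abs_of_pos hpos] at hm
  suffices ∃ (x : kˣ) (q : ℚˣ), a = x * x * Units.map (algebraMap ℚ k : ℚ →* k) q by
    obtain ⟨x, q, rfl⟩ := this
    have hx : x * x ∈ Subgroup.square kˣ := Subgroup.mem_square.mpr ⟨x, rfl⟩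
    refine Subgroup.mul_mem_sup hx (Subgroup.mem_map_of_mem _ ?_)
    exact (Subgroup.mul_mem_cancel_left _ (square_le_idealSquares hx)).mp ha
  have hq := sq_sub_trace_mul_add_norm h2 (a : k)
  rw [← hm, map_pow] at hq
  set t := Algebra.trace ℚ k (a : k)
  by_cases h : (a : k) + algebraMap ℚ k m = 0
  · have hm0 : -m ≠ 0 := by
      rintro h0
      rw [neg_eq_zero] at h0
      simp [h0] at h
    refine ⟨1, Units.mk0 (-m) hm0, ?_⟩
    ext
    simpa using eq_neg_of_add_eq_zero_left h
  · have hsq : ((a : k) + algebraMap ℚ k m) ^ 2 = a * algebraMap ℚ k (t + 2 * m) := by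
      simp only [map_add, map_mul, map_ofNat]
      linear_combination hq
    have ht : t + 2 * m ≠ 0 := fun h0 => h (by simpa [h0] using hsq)
    refine ⟨Units.mk0 _ h, (Units.mk0 _ ht)⁻¹, ?_⟩
    have ht' : algebraMap ℚ k (t + 2 * m) ≠ 0 := by simpa only [ne_eq, map_eq_zero] using ht
    ext
    simp only [Units.val_mul, Units.val_mk0, Units.coe_map, MonoidHom.coe_coe,
      Units.val_inv_eq_inv_val, map_inv₀]
    rw [← sq, hsq]
    field_simp

theorem norm_pos_of_rank_eq_zero (h2 : Module.finrank ℚ k = 2) (hr : Units.rank k = 0) {a : k}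
    (ha : a ≠ 0) : 0 < Algebra.norm ℚ a := by
  have hcard : Fintype.card (InfinitePlace k) ≤ 1 := by
    rw [Units.rank] at hr
    omega
  have hemb : Fintype.card (k →ₐ[ℚ] ℂ) = 2 := by rw [AlgHom.card, h2]
  classical
  rw [← Finset.card_univ, Finset.card_eq_two] at hemb
  obtain ⟨φ, ψ, hne, huniv⟩ := hemb
  have hmk : InfinitePlace.mk (φ : k →+* ℂ) = InfinitePlace.mk (ψ : k →+* ℂ) :=
    Fintype.card_le_one_iff.mp hcard _ _
  have hconj : ComplexEmbedding.conjugate (φ : k →+* ℂ) = ψ := by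
    refine (InfinitePlace.mk_eq_iff.mp hmk).resolve_left fun h => hne ?_
    ext x
    exact RingHom.congr_fun h x
  have hnorm := Algebra.norm_eq_prod_embeddings ℚ ℂ a
  rw [huniv, Finset.prod_pair hne] at hnorm
  have hψ : ψ a = starRingEnd ℂ (φ a) := (RingHom.congr_fun hconj a).symm
  rw [hψ, Complex.mul_conj, eq_ratCast] at hnorm
  have : ((Algebra.norm ℚ a : ℚ) : ℝ) = Complex.normSq (φ a) := by
    exact_mod_cast hnorm
  have hpos : (0 : ℝ) < (Algebra.norm ℚ a : ℚ) := by
    rw [this]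
    exact Complex.normSq_pos.mpr (by simpa using ha)
  exact_mod_cast hpos

theorem relIndex_sup_idealSquares (h2 : Module.finrank ℚ k = 2) :
    (Subgroup.square kˣ ⊔ (ratIdealSquares k).map (Units.map (algebraMap ℚ k : ℚ →* k))).relIndex
      (idealSquares k) ≠ 0 ∧
    (Subgroup.square kˣ ⊔ (ratIdealSquares k).map (Units.map (algebraMap ℚ k : ℚ →* k))).relIndex
      (idealSquares k) ≤ 2 ^ Units.rank k := by
  rcases Nat.eq_zero_or_pos (Units.rank k) with hr | hr
  · rw [Subgroup.relIndex_eq_one.mpr fun a ha =>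
      mem_sup_of_norm_pos h2 ha (norm_pos_of_rank_eq_zero h2 hr a.ne_zero), hr]
    simp
  · have hne (a : kˣ) : Algebra.norm ℚ (a : k) ≠ 0 := Algebra.norm_ne_zero_iff.mpr a.ne_zero
    have h := relIndex_le_card
      (fun a : idealSquares k => decide (0 < Algebra.norm ℚ ((a : kˣ) : k)))
      fun x y hxy => mem_sup_of_norm_pos h2 (mul_mem (inv_mem x.2) y.2) (by
        rw [decide_eq_decide] at hxy
        have hmul : Algebra.norm ℚ ((x : kˣ) : k) * Algebra.norm ℚ (((x : kˣ)⁻¹ * y : kˣ) : k) =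
            Algebra.norm ℚ ((y : kˣ) : k) := by
          rw [← map_mul, ← Units.val_mul, mul_inv_cancel_left]
        rcases (hne x).lt_or_gt with h | h
        · have hy := (hne y).lt_of_le (not_lt.mp (hxy.not.mp h.not_gt))
          rw [← hmul] at hy
          exact pos_of_mul_neg_right hy h.le
        · exact (mul_pos_iff_of_pos_left h).mp (hmul ▸ hxy.mp h))
    refine ⟨h.1, h.2.trans ?_⟩
    rw [Nat.card_eq_fintype_card, Fintype.card_bool]
    exact Nat.le_self_pow hr.ne' 2

theorem rank_le_one (h2 : Module.finrank ℚ k = 2) : Units.rank k ≤ 1 := by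
  have h := Fintype.card_le_of_surjective (InfinitePlace.mk (K := k)) fun w => ⟨_, w.mk_embedding⟩
  rw [Embeddings.card k ℂ, h2] at h
  rw [Units.rank]
  omega

theorem isSquare_of_isSquare_map {u : (𝓞 k)ˣ}
    (hu : IsSquare (Units.map (algebraMap (𝓞 k) k : 𝓞 k →* k) u)) : IsSquare u := by
  obtain ⟨x, hx⟩ := hu
  have hx' : (x : k) ^ 2 = algebraMap (𝓞 k) k u := by
    simpa [sq] using (congrArg Units.val hx).symm
  obtain ⟨y, hy⟩ := IsIntegrallyClosed.exists_algebraMap_eq_of_isIntegral_pow (R := 𝓞 k)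
    two_pos (hx' ▸ isIntegral_algebraMap : IsIntegral (𝓞 k) ((x : k) ^ 2))
  have hyu : y * y = u := by
    apply FaithfulSMul.algebraMap_injective (𝓞 k) k
    rw [map_mul, hy, ← hx', sq]
  have hyunit : IsUnit y := isUnit_of_mul_isUnit_left (hyu ▸ u.isUnit)
  exact ⟨hyunit.unit, Units.ext hyu.symm⟩

theorem exists_torsion_not_isSquare : ∃ ζ ∈ Units.torsion k, ¬ IsSquare ζ := by
  by_contra! h
  have hsurj : Function.Surjective fun ζ : Units.torsion k => ζ * ζ := by
    intro ζ
    obtain ⟨w, hw⟩ := h ζ ζ.2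
    refine ⟨⟨w, ?_⟩, Subtype.ext hw.symm⟩
    have hζ : IsOfFinOrder (w ^ 2) := by
      rw [sq, ← hw]
      exact (CommGroup.mem_torsion _).mp ζ.2
    exact (CommGroup.mem_torsion _).mpr (hζ.of_pow two_ne_zero)
  have hinj := Finite.injective_iff_surjective.mpr hsurj
  have hneg : (-1 : (𝓞 k)ˣ) ∈ Units.torsion k :=
    (CommGroup.mem_torsion _).mpr (isOfFinOrder_iff_pow_eq_one.mpr ⟨2, two_pos, by simp⟩)
  have h1 := @hinj ⟨-1, hneg⟩ 1 (Subtype.ext (by simp))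
  have h2 : (-1 : 𝓞 k) = 1 := congrArg (fun ζ : Units.torsion k => ((ζ : (𝓞 k)ˣ) : 𝓞 k)) h1
  norm_num at h2

theorem fundSystem_notMem (i : Fin (Units.rank k)) :
    Units.fundSystem k i ∉ Subgroup.square (𝓞 k)ˣ ⊔ Units.torsion k := by
  intro h
  obtain ⟨w, hw, ζ, hζ, h⟩ := Subgroup.mem_sup.mp h
  obtain ⟨y, rfl⟩ := Subgroup.mem_square.mp hw
  obtain ⟨⟨ξ, f⟩, rfl, -⟩ := Units.exist_unique_eq_mul_prod k y
  have huniq := (Units.exist_unique_eq_mul_prod k (Units.fundSystem k i)).unique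
    (y₁ := (1, Pi.single i 1)) (y₂ := (ξ * ξ * ⟨ζ, hζ⟩, f + f))
    (by
      rw [Finset.prod_eq_single i (fun j _ hj => by simp [hj]) (by simp)]
      simp)
    (by
      rw [← h]
      simp only [Pi.add_apply, zpow_add, Finset.prod_mul_distrib, Subgroup.coe_mul]
      ac_rfl)
  have := congrFun (congrArg Prod.snd huniq) i
  simp only [Pi.single_eq_same, Pi.add_apply] at this
  omega

theorem two_pow_le_index_square_units (h2 : Module.finrank ℚ k = 2)
    (h0 : (Subgroup.square (𝓞 k)ˣ).index ≠ 0) :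
    2 ^ (Units.rank k + 1) ≤ (Subgroup.square (𝓞 k)ˣ).index := by
  set M := Subgroup.square (𝓞 k)ˣ ⊔ Units.torsion k
  have hmul := Subgroup.relIndex_mul_index (le_sup_left : Subgroup.square (𝓞 k)ˣ ≤ M)
  rw [← hmul] at h0 ⊢
  obtain ⟨ζ, hζ, hζ'⟩ := exists_torsion_not_isSquare (k := k)
  have h1 := two_le_relIndex (left_ne_zero_of_mul h0) (g := ζ) (Subgroup.mem_sup_right hζ)
    fun h => hζ' (Subgroup.mem_square.mp h)
  have h3 := right_ne_zero_of_mul h0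
  rw [pow_succ, mul_comm]
  refine Nat.mul_le_mul h1 ?_
  rcases Nat.eq_zero_or_pos (Units.rank k) with hr | hr
  · rw [hr]
    exact Nat.one_le_iff_ne_zero.mpr h3
  · rw [le_antisymm (rank_le_one h2) hr, pow_one]
    rw [← Subgroup.relIndex_top_right] at h3 ⊢
    exact two_le_relIndex h3 (Subgroup.mem_top _) (fundSystem_notMem ⟨0, hr⟩)

theorem relIndex_square_integralUnits :
    (Subgroup.square kˣ).relIndex (integralUnits k) = (Subgroup.square (𝓞 k)ˣ).index := by
  rw [integralUnits, MonoidHom.range_eq_map, ← Subgroup.relIndex_comap,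
    Subgroup.relIndex_top_right]
  congr 1
  ext u
  simp only [Subgroup.mem_comap, Subgroup.mem_square]
  exact ⟨isSquare_of_isSquare_map, fun h => h.map _⟩

theorem card_two_torsion_le_relIndex
    (h0 : (Subgroup.square kˣ ⊔ integralUnits k).relIndex (idealSquares k) ≠ 0) :
    Nat.card {c : ClassGroup (𝓞 k) // c ^ 2 = 1} ≤
      (Subgroup.square kˣ ⊔ integralUnits k).relIndex (idealSquares k) := by
  have hrep (c : {c : ClassGroup (𝓞 k) // c ^ 2 = 1}) :
      ∃ (I : nonZeroDivisors (Ideal (𝓞 k))) (a : 𝓞 k), ClassGroup.mk0 I = c ∧ a ≠ 0 ∧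
        (I : Ideal (𝓞 k)) ^ 2 = Ideal.span {a} := by
    obtain ⟨I, hI⟩ := ClassGroup.mk0_surjective (c : ClassGroup (𝓞 k))
    have hp : ((I ^ 2 : nonZeroDivisors (Ideal (𝓞 k))) : Ideal (𝓞 k)).IsPrincipal := by
      rw [← ClassGroup.mk0_eq_one_iff (I ^ 2).2]
      exact (map_pow _ _ _).trans (hI ▸ c.2)
    obtain ⟨a, ha⟩ := hp
    refine ⟨I, a, hI, ?_, ha⟩
    rintro rfl
    exact nonZeroDivisors.coe_ne_zero (I ^ 2) (by simpa using ha)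
  choose I a hI ha hIa using hrep
  have ha' (c) : algebraMap (𝓞 k) k (a c) ≠ 0 := by simpa using ha c
  refine card_le_relIndex h0
    (fun c => ⟨Units.mk0 _ (ha' c), 1, a c, I c, by simp, hIa c⟩) fun c c' h => ?_
  obtain ⟨_, hw, _, ⟨u, rfl⟩, h⟩ := Subgroup.mem_sup.mp h
  obtain ⟨x, rfl⟩ := Subgroup.mem_square.mp hw
  obtain ⟨y, z, hz, hyz⟩ := IsFractionRing.div_surjective (A := 𝓞 k) (x : k)
  have hz0 : z ≠ 0 := nonZeroDivisors.ne_zero hz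
  have hz' : algebraMap (𝓞 k) k z ≠ 0 := by simpa using hz0
  have hy0 : y ≠ 0 := by
    rintro rfl
    exact x.ne_zero (by simp [← hyz])
  have heq : y ^ 2 * a c * u = z ^ 2 * a c' := by
    apply FaithfulSMul.algebraMap_injective (𝓞 k) k
    have := congrArg Units.val h
    simp only [Units.val_mul, Units.coe_map, MonoidHom.coe_coe, Units.val_inv_eq_inv_val,
      Units.val_mk0, ← hyz] at this
    have hac := ha' c
    simp only [map_mul, map_pow]
    field_simp at this
    linear_combination this
  have hsq : (Ideal.span {y} * (I c : Ideal (𝓞 k))) ^ 2 =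
      (Ideal.span {z} * (I c' : Ideal (𝓞 k))) ^ 2 := by
    rw [mul_pow, mul_pow, hIa, hIa, Ideal.span_singleton_pow, Ideal.span_singleton_pow,
      Ideal.span_singleton_mul_span_singleton, Ideal.span_singleton_mul_span_singleton, ← heq,
      Ideal.span_singleton_mul_right_unit u.isUnit]
  apply Subtype.ext
  rw [← hI c, ← hI c', ClassGroup.mk0_eq_mk0_iff]
  exact ⟨y, z, hy0, hz0, pow_left_injective two_ne_zero hsq⟩

end QuadraticGenus

open QuadraticGenus in
/-- Gauss's genus theory: for a quadratic field `k` in which `t` rational primes ramify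
(equivalently, `t` primes divide the discriminant), the 2-torsion of the class group has
order at most `2^{t-1}`. -/
theorem classGroup_two_torsion_le (k : Type) [Field k] [NumberField k]
    (h2 : Module.finrank ℚ k = 2) :
    Nat.card {c : ClassGroup (𝓞 k) // c ^ 2 = 1} ≤
      2 ^ ((NumberField.discr k).natAbs.primeFactors.card - 1) := by
  obtain ⟨hrat0, hrat⟩ := relIndex_square_map_ratIdealSquares h2
  obtain ⟨hsup0, hsup⟩ := relIndex_sup_idealSquares h2
  set Q := (ratIdealSquares k).map (Units.map (algebraMap ℚ k : ℚ →* k))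
  have hQ : Subgroup.square kˣ ⊔ Q ≤ idealSquares k :=
    sup_le square_le_idealSquares (Subgroup.map_comap_le _ _)
  have hE : Subgroup.square kˣ ⊔ integralUnits k ≤ idealSquares k :=
    sup_le square_le_idealSquares integralUnits_le_idealSquares
  have hmulQ := Subgroup.relIndex_mul_relIndex _ _ _ le_sup_left hQ
  have hmulE := Subgroup.relIndex_mul_relIndex _ _ _ le_sup_left hE
  rw [Subgroup.relIndex_sup_left] at hmulQ hmulE
  rw [relIndex_square_integralUnits, ← hmulQ] at hmulE
  have hne := hmulE ▸ mul_ne_zero hrat0 hsup0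
  have hunits := two_pow_le_index_square_units h2 (left_ne_zero_of_mul hne)
  have hcl := card_two_torsion_le_relIndex (right_ne_zero_of_mul hne)
  set t := (discr k).natAbs.primeFactors.card
  set r := Units.rank k
  set C := Nat.card {c : ClassGroup (𝓞 k) // c ^ 2 = 1}
  have hC : C * 2 ≤ 2 ^ t := by
    have h := (Nat.mul_le_mul hunits hcl).trans (hmulE.le.trans (Nat.mul_le_mul hrat hsup))
    refine Nat.le_of_mul_le_mul_left (c := 2 ^ r) ?_ (by positivity)
    calc
      2 ^ r * (C * 2) = 2 ^ (r + 1) * C := by ring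
      _ ≤ 2 ^ r * 2 ^ t := h.trans_eq (mul_comm _ _)
  have hC0 : 0 < C := Nat.card_pos_iff.mpr ⟨⟨1, one_pow 2⟩, inferInstance⟩
  rcases Nat.eq_zero_or_pos t with ht | ht
  · rw [ht] at hC
    omega
  · obtain ⟨n, hn⟩ := Nat.exists_eq_succ_of_ne_zero ht.ne'
    rw [hn, pow_succ] at hC
    rw [hn]
    exact Nat.le_of_mul_le_mul_right hC two_pos
end

section
/- Let ζ_k be the Dedekind zeta function of a number field k and Q_k(x) the number of squarefree ideals of O_k with norm ≤ x. Then Q_k(x) = (Res_{s=1} ζ_k / ζ_k(2))·x + o(x) as x → ∞. -/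
open NumberField Filter
open UniqueFactorizationMonoid

section UniqueFactorizationMonoid
variable {α : Type*} [CommMonoidWithZero α] [UniqueFactorizationMonoid α]

open scoped Classical in
theorem moebius_irreducible_mul {p : α} (hp : Irreducible p) (a : α) :
    moebius (p * a) = if p ∣ a then 0 else -moebius a := by
  split_ifs with h
  · refine moebius_of_not_squarefree fun hs => hp.not_isUnit (hs p (mul_dvd_mul_left p h))
  · rw [(hp.isRelPrime_iff_not_dvd.mpr h).moebius_mul, hp.moebius_eq, neg_one_mul]

theorem sum_moebius_of_mem_iff_dvd [Nontrivial α] [Subsingleton αˣ] [DecidableEq α] {b : α}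
    (hb : b ≠ 0) {s : Finset α} (hs : ∀ a, a ∈ s ↔ a ∣ b) :
    ∑ a ∈ s, moebius a = if b = 1 then 1 else 0 := by
  classical
  split_ifs with h1
  · subst h1
    have : s = {1} := by ext; simp [hs, ← isUnit_iff_dvd_one, isUnit_iff_eq_one]
    simp [this]
  obtain ⟨p, hp, c, rfl⟩ :=
    WfDvdMonoid.exists_irreducible_factor (fun h => h1 (isUnit_iff_eq_one.mp h)) hb
  have hp0 := hp.ne_zero
  have hdvd : s.filter (p ∣ ·) = (s.filter (· ∣ c)).image (p * ·) := by
    ext a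
    simp only [Finset.mem_filter, Finset.mem_image, hs]
    constructor
    · rintro ⟨h, d, rfl⟩
      have := (mul_dvd_mul_iff_left hp0).mp h
      exact ⟨d, ⟨this.mul_left _, this⟩, rfl⟩
    · rintro ⟨d, ⟨_, h⟩, rfl⟩
      exact ⟨mul_dvd_mul_left p h, dvd_mul_right _ _⟩
  have hnot_dvd : s.filter (¬ p ∣ ·) = (s.filter (· ∣ c)).filter (¬ p ∣ ·) := by
    ext a
    simp only [Finset.mem_filter, hs]
    constructor
    · rintro ⟨h, h'⟩
      exact ⟨⟨h, (hp.isRelPrime_iff_not_dvd.mpr h').symm.dvd_of_dvd_mul_left h⟩, h'⟩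
    · tauto
  rw [← Finset.sum_filter_add_sum_filter_not s (p ∣ ·), hdvd, hnot_dvd,
    Finset.sum_image fun x _ y _ h => mul_left_cancel₀ hp0 h]
  simp only [moebius_irreducible_mul hp]
  simp [Finset.sum_ite]

theorem exists_sq_mul_squarefree {a : α} (ha : a ≠ 0) :
    ∃ b c : α, Squarefree c ∧ a = b * b * c := by
  induction a using (wellFounded_dvdNotUnit (α := α)).induction with
  | _ a ih =>
  by_cases hs : Squarefree a
  · exact ⟨1, a, hs, by simp⟩
  · obtain ⟨x, ⟨y, rfl⟩, hx⟩ : ∃ x, x * x ∣ a ∧ ¬ IsUnit x := by simpa [Squarefree] using hs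
    have hy : y ≠ 0 := right_ne_zero_of_mul ha
    obtain ⟨b, c, hc, rfl⟩ :=
      ih y ⟨hy, x * x, fun h => hx (isUnit_of_mul_isUnit_left h), mul_comm _ _⟩ hy
    exact ⟨x * b, c, hc, by ac_rfl⟩

theorem mul_self_dvd_mul_self_mul_iff {b c d : α} (hb : b ≠ 0) (hc : Squarefree c) :
    d * d ∣ b * b * c ↔ d ∣ b := by
  refine ⟨fun h => ?_, fun h => (mul_dvd_mul h h).mul_right c⟩
  obtain ⟨b', d', g, hr, rfl, rfl⟩ := UniqueFactorizationMonoid.exists_reduced_factors b hb d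
  have hg : g ≠ 0 := left_ne_zero_of_mul hb
  have h2 : d' * d' ∣ b' * b' * c := by
    rw [← mul_dvd_mul_iff_left (mul_ne_zero hg hg)]
    convert h using 1 <;> ac_rfl
  have h3 : d' * d' ∣ c := by
    refine IsRelPrime.dvd_of_dvd_mul_left ?_ h2
    have := hr.symm
    exact (this.mul_right this).mul_left (this.mul_right this)
  exact mul_dvd_mul_left g (hc d' h3).dvd

theorem sum_moebius_of_mem_iff_mul_self_dvd [Nontrivial α] [Subsingleton αˣ]
    [DecidablePred (Squarefree : α → Prop)] {a : α} (ha : a ≠ 0) {s : Finset α}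
    (hs : ∀ d, d ∈ s ↔ d * d ∣ a) :
    ∑ d ∈ s, moebius d = if Squarefree a then 1 else 0 := by
  classical
  obtain ⟨b, c, hc, rfl⟩ := exists_sq_mul_squarefree ha
  have hb : b ≠ 0 := by rintro rfl; simp at ha
  rw [sum_moebius_of_mem_iff_dvd hb fun d => (hs d).trans (mul_self_dvd_mul_self_mul_iff hb hc)]
  congr 1
  refine propext ⟨?_, fun h => isUnit_iff_eq_one.mp (h b (dvd_mul_right _ _))⟩
  rintro rfl
  simpa using hc

theorem abs_moebius_le_one (a : α) : |moebius a| ≤ 1 := by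
  by_cases h : Squarefree a <;> simp [h]
end UniqueFactorizationMonoid

section NumberField
variable (K : Type*) [Field K] [NumberField K]

theorem finite_ne_zero_absNorm_le (x : ℝ) :
    {I : Ideal (𝓞 K) | I ≠ 0 ∧ (I.absNorm : ℝ) ≤ x}.Finite :=
  (Ideal.finite_setOfPred_absNorm_le ⌊x⌋₊).subset fun _ h => Nat.le_floor h.2

/-- The number of nonzero ideals of norm at most `x`. -/
noncomputable def idealCount (x : ℝ) : ℕ :=
  Set.ncard {I : Ideal (𝓞 K) | I ≠ 0 ∧ (I.absNorm : ℝ) ≤ x}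

theorem tendsto_idealCount_div :
    Tendsto (fun x : ℝ => (idealCount K x : ℝ) / x) atTop (nhds (dedekindZeta_residue K)) := by
  refine (Ideal.tendsto_norm_le_div_atTop₀ K).congr fun x => ?_
  congr 2
  rw [idealCount, ← Nat.card_coe_set_eq]
  refine Nat.card_congr ((Equiv.subtypeSubtypeEquivSubtypeInter _
    (fun I : Ideal (𝓞 K) => (I.absNorm : ℝ) ≤ x)).trans (Equiv.subtypeEquivRight fun I => ?_))
  simp [mem_nonZeroDivisors_iff_ne_zero]

theorem idealCount_eq_zero_of_lt_one {x : ℝ} (hx : x < 1) : idealCount K x = 0 := by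
  rw [idealCount, Set.ncard_eq_zero (finite_ne_zero_absNorm_le K x), Set.eq_empty_iff_forall_notMem]
  rintro I ⟨h0, h⟩
  have : 1 ≤ I.absNorm := Nat.one_le_iff_ne_zero.mpr (mt Ideal.absNorm_eq_zero_iff.mp h0)
  have : (1 : ℝ) ≤ I.absNorm := by exact_mod_cast this
  linarith

theorem exists_idealCount_le_mul : ∃ C : ℝ, 0 ≤ C ∧ ∀ x : ℝ, 0 ≤ x → idealCount K x ≤ C * x := by
  have h := (tendsto_idealCount_div K).eventually_le_const (lt_add_one _)
  obtain ⟨T, hT⟩ := eventually_atTop.mp h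
  have hρ := dedekindZeta_residue_pos K
  refine ⟨(dedekindZeta_residue K + 1) + idealCount K T, by positivity, fun x hx => ?_⟩
  rcases lt_or_ge x 1 with h1 | h1
  · rw [idealCount_eq_zero_of_lt_one K h1]; simp only [Nat.cast_zero]; positivity
  rcases le_total T x with hTx | hTx
  · have := (div_le_iff₀ (by linarith)).mp (hT x hTx)
    nlinarith [(idealCount K T).cast_nonneg (α := ℝ)]
  · have : idealCount K x ≤ idealCount K T :=
      Set.ncard_le_ncard (fun I hI => ⟨hI.1, hI.2.trans hTx⟩) (finite_ne_zero_absNorm_le K T)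
    have : (idealCount K x : ℝ) ≤ idealCount K T := by exact_mod_cast this
    nlinarith [(idealCount K T).cast_nonneg (α := ℝ)]

theorem sum_card_absNorm_eq (n : ℕ) :
    ∑ m ∈ Finset.Icc 1 n, Nat.card {I : Ideal (𝓞 K) // I.absNorm = m} = idealCount K n := by
  classical
  have hfin := finite_ne_zero_absNorm_le K n
  rw [idealCount, Set.ncard_eq_toFinset_card _ hfin,
    Finset.card_eq_sum_card_fiberwise (f := Ideal.absNorm) (t := Finset.Icc 1 n)]
  · refine Finset.sum_congr rfl fun m hm => ?_
    rw [← Set.ncard_coe_finset, ← Nat.card_coe_set_eq]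
    refine Nat.card_congr (Equiv.subtypeEquivRight fun I => ?_)
    obtain ⟨h1, h2⟩ := Finset.mem_Icc.mp hm
    simp only [Finset.coe_filter, Set.Finite.mem_toFinset, Set.mem_ofPred_eq, Nat.cast_le]
    refine ⟨fun h => ⟨⟨?_, h ▸ h2⟩, h⟩, fun h => h.2⟩
    rintro rfl
    simp at h
    omega
  · intro I hI
    simp only [Set.Finite.coe_toFinset, Set.mem_ofPred_eq, Nat.cast_le] at hI
    exact Finset.mem_coe.mpr (Finset.mem_Icc.mpr
      ⟨Nat.one_le_iff_ne_zero.mpr (mt Ideal.absNorm_eq_zero_iff.mp hI.1), hI.2⟩)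

theorem LSeriesSummable_card_absNorm_eq {s : ℝ} (hs : 1 < s) :
    LSeriesSummable (fun n ↦ (Nat.card {I : Ideal (𝓞 K) // I.absNorm = n} : ℂ)) s := by
  refine LSeriesSummable_of_sum_norm_bigO_and_nonneg
    (f := fun n => (Nat.card {I : Ideal (𝓞 K) // I.absNorm = n} : ℝ)) (r := 1) ?_
    (fun _ => Nat.cast_nonneg _) zero_le_one hs
  obtain ⟨C, -, hC⟩ := exists_idealCount_le_mul K
  refine Asymptotics.IsBigO.of_bound C (Eventually.of_forall fun n => ?_)
  rw [← Nat.cast_sum, sum_card_absNorm_eq, Real.rpow_one, Real.norm_natCast, Real.norm_natCast]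
  exact hC n n.cast_nonneg

theorem hasSum_absNorm_rpow_neg {s : ℝ} (hs : 1 < s) :
    HasSum (fun I : Ideal (𝓞 K) => (I.absNorm : ℝ) ^ (-s)) (dedekindZeta K s).re := by
  have hL := LSeriesSummable_card_absNorm_eq K hs
  have hg : HasSum
      (fun n : ℕ => (Nat.card {I : Ideal (𝓞 K) // I.absNorm = n} : ℝ) * (n : ℝ) ^ (-s))
      (dedekindZeta K s).re := by
    refine (Complex.hasSum_re hL.hasSum).congr_fun fun n => ?_
    rw [LSeries.term_def]
    split_ifs with hn
    · simp [hn, Real.zero_rpow (show -s ≠ 0 by linarith)]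
    · rw [Real.rpow_neg n.cast_nonneg, ← Complex.ofReal_natCast n,
        ← Complex.ofReal_cpow n.cast_nonneg, ← Complex.ofReal_natCast,
        ← Complex.ofReal_div, Complex.ofReal_re, div_eq_mul_inv]
  rw [← (Equiv.sigmaFiberEquiv (Ideal.absNorm : Ideal (𝓞 K) → ℕ)).hasSum_iff]
  have hfib (n : ℕ) : HasSum
      (fun I : {I : Ideal (𝓞 K) // I.absNorm = n} => (I.1.absNorm : ℝ) ^ (-s))
      (Nat.card {I : Ideal (𝓞 K) // I.absNorm = n} * (n : ℝ) ^ (-s)) := by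
    have : Finite {I : Ideal (𝓞 K) // I.absNorm = n} := Ideal.finite_setOfPred_absNorm_eq n
    have := Fintype.ofFinite {I : Ideal (𝓞 K) // I.absNorm = n}
    have h := hasSum_fintype fun I : {I : Ideal (𝓞 K) // I.absNorm = n} => (I.1.absNorm : ℝ) ^ (-s)
    rwa [Finset.sum_congr rfl fun I _ => by rw [I.2], Finset.sum_const, nsmul_eq_mul,
      Finset.card_univ, ← Nat.card_eq_fintype_card] at h
  refine HasSum.sigma_of_hasSum hg hfib ?_
  refine (summable_sigma_of_nonneg fun _ => by simp only [Function.comp]; positivity).mpr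
    ⟨fun n => (hfib n).summable, ?_⟩
  exact hg.summable.congr fun n => (hfib n).tsum_eq.symm

theorem summable_inv_absNorm_sq :
    Summable fun I : Ideal (𝓞 K) => ((I.absNorm : ℝ) ^ 2)⁻¹ := by
  refine (hasSum_absNorm_rpow_neg K (s := 2) (by norm_num)).summable.congr fun I => ?_
  rw [Real.rpow_neg (by positivity)]
  norm_cast

open scoped Classical in
theorem tsum_moebius_mul_tsum_inv_absNorm_sq :
    (∑' J : Ideal (𝓞 K), (moebius J : ℝ) * ((J.absNorm : ℝ) ^ 2)⁻¹) *
      ∑' I : Ideal (𝓞 K), ((I.absNorm : ℝ) ^ 2)⁻¹ = 1 := by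
  have hsum := summable_inv_absNorm_sq K
  let F (J L : Ideal (𝓞 K)) : ℝ := if J ∣ L then moebius J * ((L.absNorm : ℝ) ^ 2)⁻¹ else 0
  have hrow (f : ℤ → ℝ) (hf : f 0 = 0) (J : Ideal (𝓞 K)) :
      HasSum (fun L : Ideal (𝓞 K) => if J ∣ L then f (moebius J) * ((L.absNorm : ℝ) ^ 2)⁻¹ else 0)
      (f (moebius J) * ((J.absNorm : ℝ) ^ 2)⁻¹ * ∑' I : Ideal (𝓞 K), ((I.absNorm : ℝ) ^ 2)⁻¹) := by
    rcases eq_or_ne J 0 with rfl | hJ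
    · simp only [moebius_zero, hf, zero_mul, ite_self]
      exact hasSum_zero
    rw [← (mul_right_injective₀ hJ).hasSum_iff]
    · refine (hsum.hasSum.mul_left _).congr_fun fun I => ?_
      simp [mul_pow, mul_assoc, mul_comm]
    · intro L hL
      refine if_neg fun h => hL ?_
      obtain ⟨M, rfl⟩ := h
      exact ⟨M, rfl⟩
  have hF : Summable (Function.uncurry F) := by
    refine Summable.of_norm ?_
    have habs := hrow (fun n => |(n : ℝ)|) (by simp)
    have heq (J L) : ‖F J L‖ =
        if J ∣ L then |(moebius J : ℝ)| * ((L.absNorm : ℝ) ^ 2)⁻¹ else 0 := by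
      simp only [F]; split_ifs <;> simp
    refine (summable_prod_of_nonneg fun _ => norm_nonneg _).mpr ⟨fun J => ?_, ?_⟩
    · simpa only [Function.uncurry, heq] using (habs J).summable
    · simp only [Function.uncurry, heq, (habs _).tsum_eq]
      refine Summable.mul_right _
        (Summable.of_nonneg_of_le (fun _ => by positivity) (fun J => ?_) hsum)
      exact mul_le_of_le_one_left (by positivity) (by exact_mod_cast abs_moebius_le_one J)
  have hcol (L : Ideal (𝓞 K)) : ∑' J, F J L = if L = 1 then 1 else 0 := by
    rcases eq_or_ne L 0 with rfl | hL
    · simp [F]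
    have hfin : {J : Ideal (𝓞 K) | J ∣ L}.Finite := by
      have := fintypeSubtypeDvd L hL
      exact Set.finite_coe_iff.mp (Finite.of_fintype {J // J ∣ L})
    rw [tsum_eq_sum (s := hfin.toFinset) (by intro J hJ; simp [F] at hJ ⊢; tauto),
      Finset.sum_congr rfl (g := fun J => (moebius J : ℝ) * ((L.absNorm : ℝ) ^ 2)⁻¹)
        (by intro J hJ; simp at hJ; simp [F, hJ]),
      ← Finset.sum_mul, ← Int.cast_sum, sum_moebius_of_mem_iff_dvd hL (by simp)]
    split_ifs with h <;> simp [h]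
  rw [← tsum_mul_right, tsum_congr fun J => (hrow (fun n => (n : ℝ)) (by simp) J).tsum_eq.symm]
  change ∑' J, ∑' L, F J L = 1
  rw [← hF.tsum_comm, tsum_congr hcol, tsum_ite_eq]

theorem ncard_squarefree_eq_tsum (x : ℝ) :
    (Set.ncard {I : Ideal (𝓞 K) | Squarefree I ∧ (I.absNorm : ℝ) ≤ x} : ℝ) =
      ∑' J : Ideal (𝓞 K), (moebius J : ℝ) * idealCount K (x / (J.absNorm : ℝ) ^ 2) := by
  classical
  have hfin := finite_ne_zero_absNorm_le K x
  set S := hfin.toFinset with hS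
  have hmem (I : Ideal (𝓞 K)) : I ∈ S ↔ I ≠ 0 ∧ (I.absNorm : ℝ) ≤ x := by simp [hS]
  have hone {I : Ideal (𝓞 K)} (hI : I ≠ 0) : (1 : ℝ) ≤ I.absNorm := by
    exact_mod_cast Nat.one_le_iff_ne_zero.mpr (mt Ideal.absNorm_eq_zero_iff.mp hI)
  have hdvd {I J : Ideal (𝓞 K)} (hI : I ∈ S) (h : J * J ∣ I) : J ∈ S := by
    rw [hmem] at hI ⊢
    have hJ : J ≠ 0 := by
      rintro rfl
      exact hI.1 (zero_dvd_iff.mp (by rwa [zero_mul] at h))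
    refine ⟨hJ, le_trans ?_ hI.2⟩
    exact_mod_cast Nat.le_of_dvd (by exact_mod_cast zero_lt_one.trans_le (hone hI.1))
      (map_dvd Ideal.absNorm ((dvd_mul_right J J).trans h))
  have hcount {J : Ideal (𝓞 K)} (hJ : J ≠ 0) :
      (S.filter (J * J ∣ ·)).card = idealCount K (x / (J.absNorm : ℝ) ^ 2) := by
    have hN : (0 : ℝ) < J.absNorm := zero_lt_one.trans_le (hone hJ)
    rw [idealCount, ← Set.ncard_image_of_injective _ (mul_right_injective₀ (mul_ne_zero hJ hJ)),
      ← Set.ncard_coe_finset]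
    congr 1
    ext I
    simp only [Finset.coe_filter, hmem, Set.mem_ofPred_eq, Set.mem_image]
    have hle (M : Ideal (𝓞 K)) :
        (M.absNorm : ℝ) ≤ x / (J.absNorm : ℝ) ^ 2 ↔ ((J * J * M).absNorm : ℝ) ≤ x := by
      rw [le_div_iff₀ (by positivity)]
      simp only [map_mul, Nat.cast_mul]
      ring_nf
    constructor
    · rintro ⟨⟨h0, h⟩, M, rfl⟩
      exact ⟨M, ⟨right_ne_zero_of_mul h0, (hle M).mpr h⟩, rfl⟩
    · rintro ⟨M, ⟨h0, h⟩, rfl⟩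
      exact ⟨⟨mul_ne_zero (mul_ne_zero hJ hJ) h0, (hle M).mp h⟩, dvd_mul_right _ _⟩
  have hsq : {I : Ideal (𝓞 K) | Squarefree I ∧ (I.absNorm : ℝ) ≤ x} = S.filter Squarefree := by
    ext I
    simp only [Set.mem_ofPred_eq, Finset.coe_filter, hmem]
    exact ⟨fun h => ⟨⟨h.1.ne_zero, h.2⟩, h.1⟩, fun h => ⟨h.2, h.1.2⟩⟩
  rw [tsum_eq_sum (s := S)]
  · rw [hsq, Set.ncard_coe_finset, Finset.card_filter]
    calc ((∑ I ∈ S, if Squarefree I then 1 else 0 : ℕ) : ℝ)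
        = ∑ I ∈ S, ∑ J ∈ S.filter (fun J => J * J ∣ I), (moebius J : ℝ) := by
          push_cast
          refine Finset.sum_congr rfl fun I hI => ?_
          rw [← Int.cast_sum, sum_moebius_of_mem_iff_mul_self_dvd ((hmem I).mp hI).1 (by
            intro J
            simp only [Finset.mem_filter, and_iff_right_iff_imp]
            exact hdvd hI)]
          push_cast
          rfl
      _ = ∑ J ∈ S, ∑ I ∈ S.filter (J * J ∣ ·), (moebius J : ℝ) :=
          Finset.sum_comm' (by simp only [Finset.mem_filter]; tauto)
      _ = _ := by
          refine Finset.sum_congr rfl fun J hJ => ?_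
          rw [Finset.sum_const, hcount ((hmem J).mp hJ).1, nsmul_eq_mul, mul_comm]
  · intro J hJ
    rcases eq_or_ne J 0 with rfl | h0
    · rw [moebius_zero, Int.cast_zero, zero_mul]
    have hJx : x < J.absNorm := not_le.mp fun h => hJ ((hmem J).mpr ⟨h0, h⟩)
    have := hone h0
    rw [idealCount_eq_zero_of_lt_one K, Nat.cast_zero, mul_zero]
    rw [div_lt_one (by positivity)]
    nlinarith

theorem tendsto_ncard_squarefree_div :
    Tendsto (fun x : ℝ =>
        (Set.ncard {I : Ideal (𝓞 K) | Squarefree I ∧ (I.absNorm : ℝ) ≤ x} : ℝ) / x)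
      atTop (nhds (dedekindZeta_residue K / ∑' I : Ideal (𝓞 K), ((I.absNorm : ℝ) ^ 2)⁻¹)) := by
  obtain ⟨C, hC, hbound⟩ := exists_idealCount_le_mul K
  have hlim : dedekindZeta_residue K / ∑' I : Ideal (𝓞 K), ((I.absNorm : ℝ) ^ 2)⁻¹ =
      ∑' J : Ideal (𝓞 K), (moebius J : ℝ) * (dedekindZeta_residue K * ((J.absNorm : ℝ) ^ 2)⁻¹) := by
    have h := tsum_moebius_mul_tsum_inv_absNorm_sq K
    rw [div_eq_mul_inv, ← eq_inv_of_mul_eq_one_left h, ← tsum_mul_left]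
    exact tsum_congr fun J => mul_left_comm _ _ _
  rw [hlim]
  simp_rw [ncard_squarefree_eq_tsum, ← tsum_div_const, mul_div_assoc]
  refine tendsto_tsum_of_dominated_convergence
    (bound := fun J => C * ((J.absNorm : ℝ) ^ 2)⁻¹) ((summable_inv_absNorm_sq K).mul_left C)
    (fun J => ?_) ?_
  · rcases eq_or_ne J 0 with rfl | hJ
    · simp only [moebius_zero, Int.cast_zero, zero_mul]
      exact tendsto_const_nhds
    have hN : (0 : ℝ) < (J.absNorm : ℝ) ^ 2 := by
      have : J.absNorm ≠ 0 := mt Ideal.absNorm_eq_zero_iff.mp hJ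
      positivity
    refine Tendsto.const_mul _ ?_
    refine (((tendsto_idealCount_div K).comp (tendsto_id.atTop_div_const hN)).mul_const
      ((J.absNorm : ℝ) ^ 2)⁻¹).congr fun x => ?_
    rw [Function.comp, id, div_div_eq_mul_div, div_mul_eq_mul_div, mul_inv_cancel_right₀ hN.ne']
  · filter_upwards [eventually_gt_atTop 0] with x hx J
    have h1 : |(moebius J : ℝ)| ≤ 1 := by exact_mod_cast abs_moebius_le_one J
    rw [norm_mul, Real.norm_eq_abs, Real.norm_of_nonneg (by positivity)]
    refine (mul_le_of_le_one_left (by positivity) h1).trans ?_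
    rw [div_le_iff₀ hx]
    refine (hbound _ (by positivity)).trans_eq ?_
    ring

theorem tendsto_sub_one_mul_tsum_absNorm_rpow_neg :
    Tendsto (fun s : ℝ => (s - 1) * ∑' I : Ideal (𝓞 K), (I.absNorm : ℝ) ^ (-s))
      (nhdsWithin 1 (Set.Ioi 1)) (nhds (dedekindZeta_residue K)) := by
  have h := (Complex.continuous_re.tendsto _).comp (tendsto_sub_one_mul_dedekindZeta_nhdsGT K)
  refine h.congr' ?_
  filter_upwards [self_mem_nhdsWithin] with s hs
  rw [(hasSum_absNorm_rpow_neg K hs).tsum_eq, Function.comp, ← Complex.ofReal_one,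
    ← Complex.ofReal_sub, Complex.re_ofReal_mul]

end NumberField

/-- If `R` is the residue of the Dedekind zeta function of `k` at `s = 1`, then the number
`Q_k(x)` of squarefree ideals of norm at most `x` satisfies
`Q_k(x) = (R / ζ_k(2))·x + o(x)` as `x → ∞`. -/
theorem squarefree_ideal_count_asymptotic (k : Type) [Field k] [NumberField k] (R : ℝ)
    (hR : Filter.Tendsto
      (fun s : ℝ => (s - 1) * ∑' I : Ideal (𝓞 k), (Ideal.absNorm I : ℝ) ^ (-s))
      (nhdsWithin 1 (Set.Ioi 1)) (nhds R)) :
    (fun x : ℝ =>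
        (Set.ncard {I : Ideal (𝓞 k) | Squarefree I ∧ (Ideal.absNorm I : ℝ) ≤ x} : ℝ) -
          (R / ∑' I : Ideal (𝓞 k), ((Ideal.absNorm I : ℝ) ^ 2)⁻¹) * x)
      =o[Filter.atTop] (fun x : ℝ => x) := by
  obtain rfl := tendsto_nhds_unique hR (tendsto_sub_one_mul_tsum_absNorm_rpow_neg k)
  rw [Asymptotics.isLittleO_iff_tendsto' ((eventually_ne_atTop 0).mono fun x hx h => absurd h hx)]
  refine (tendsto_sub_nhds_zero_iff.mpr (tendsto_ncard_squarefree_div k)).congr' ?_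
  filter_upwards [eventually_ne_atTop 0] with x hx
  rw [sub_div, mul_div_cancel_right₀ _ hx]
end
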